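/- arXiv:1803.02435 — 2 statements merged into one kernel-verified Lean document; each statement's English description precedes it below -/
import Mathlib

section
/- Let H be a complex Hilbert space and A_1,…,A_n bounded operators on H with ‖Σ_{k=1}^n A_k*A_k‖ ≤ n and ‖Σ_{k=1}^n A_k A_k*‖ ≤ n, and set C = max_{1≤k≤n} ‖A_k*A_k‖, assumed positive. Let j ≥ 2 and let σ be an equivalence relation (partition) on {1,…,j} with ν(σ) equivalence classes such that the class of the element 1 contains at least two elements. Then ‖ Σ_{(i_1,…,i_j): ⟨i⟩=σ} A_{i_j}* ⋯ A_{i_2}* (1 − A_{i_1}* A_{i_1}) A_{i_2} ⋯ A_{i_j} ‖ ≤ n^{ν(σ)} · C^{j−ν(σ)} · (1 + 1/C). -/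
open scoped BigOperators Classical

noncomputable section

variable {H : Type*} [NormedAddCommGroup H] [InnerProductSpace ℂ H] [CompleteSpace H]

/-- A family of operators whose column `x ↦ (B i x)ᵢ` has norm at most `√K` satisfies
`‖∑ (B i)* B i‖ ≤ K`. -/
lemma norm_sum_adjoint_mul_self_le {ι : Type*} (s : Finset ι) (B : ι → H →L[ℂ] H) {K : ℝ}
    (hK : 0 ≤ K) (hB : ∀ x, ∑ i ∈ s, ‖B i x‖ ^ 2 ≤ K * ‖x‖ ^ 2) :
    ‖∑ i ∈ s, ContinuousLinearMap.adjoint (B i) * B i‖ ≤ K := by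
  set T := ∑ i ∈ s, ContinuousLinearMap.adjoint (B i) * B i with hT
  have key : ∀ x y, ‖inner ℂ y (T x)‖ ≤ K * ‖x‖ * ‖y‖ := by
    intro x y
    have h : inner ℂ y (T x) = ∑ i ∈ s, inner ℂ (B i y) (B i x) := by
      simp [hT, sum_apply, ContinuousLinearMap.adjoint_inner_right]
    have h2 : ‖inner ℂ y (T x)‖ ≤ ∑ i ∈ s, ‖B i y‖ * ‖B i x‖ := by
      rw [h]
      exact (norm_sum_le _ _).trans (Finset.sum_le_sum fun i _ => norm_inner_le_norm _ _)
    refine h2.trans (abs_le_of_sq_le_sq' ?_ (by positivity)).2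
    calc (∑ i ∈ s, ‖B i y‖ * ‖B i x‖) ^ 2
        ≤ (∑ i ∈ s, ‖B i y‖ ^ 2) * ∑ i ∈ s, ‖B i x‖ ^ 2 := Finset.sum_mul_sq_le_sq_mul_sq _ _ _
      _ ≤ (K * ‖y‖ ^ 2) * (K * ‖x‖ ^ 2) :=
          mul_le_mul (hB y) (hB x) (by positivity) (by positivity)
      _ = (K * ‖x‖ * ‖y‖) ^ 2 := by ring
  refine ContinuousLinearMap.opNorm_le_bound _ hK fun x => ?_
  have h := key x (T x)
  rw [inner_self_eq_norm_sq_to_K] at h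
  simp only [norm_pow, RCLike.norm_ofReal, abs_norm] at h
  rcases (norm_nonneg (T x)).eq_or_lt with h0 | h0
  · rw [← h0]; positivity
  · exact le_of_mul_le_mul_right (by linarith [sq ‖T x‖]) h0

lemma sum_norm_sq_apply_le {ι : Type*} (s : Finset ι) (B : ι → H →L[ℂ] H) {K : ℝ}
    (hB : ‖∑ i ∈ s, ContinuousLinearMap.adjoint (B i) * B i‖ ≤ K) (x : H) :
    ∑ i ∈ s, ‖B i x‖ ^ 2 ≤ K * ‖x‖ ^ 2 := by
  set T := ∑ i ∈ s, ContinuousLinearMap.adjoint (B i) * B i with hT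
  have h : inner ℂ x (T x) = ((∑ i ∈ s, ‖B i x‖ ^ 2 : ℝ) : ℂ) := by
    simp [hT, sum_apply, ContinuousLinearMap.adjoint_inner_right]
  calc ∑ i ∈ s, ‖B i x‖ ^ 2 = ‖inner ℂ x (T x)‖ := by
        rw [h, Complex.norm_real, Real.norm_of_nonneg (by positivity)]
    _ ≤ ‖x‖ * ‖T x‖ := norm_inner_le_norm _ _
    _ ≤ ‖x‖ * (K * ‖x‖) := by
        gcongr
        exact T.le_of_opNorm_le hB x
    _ = K * ‖x‖ ^ 2 := by ring

lemma sum_update_eq_card_mul_sum {Q α : Type*} [Fintype Q] [DecidableEq Q] [Fintype α]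
    (q : Q) (F : (Q → α) → ℝ) :
    ∑ f, ∑ k, F (Function.update f q k) = Fintype.card α * ∑ f, F f := by
  have e : ∀ k : α, ∀ f : Q → α, Function.update f q k =
      (Equiv.funSplitAt q α).symm (k, ((Equiv.funSplitAt q α) f).2) := by
    intro k f
    ext a
    by_cases h : a = q
    · subst h; simp
    · simp [h]
  rw [← (Equiv.funSplitAt q α).symm.sum_comp, ← (Equiv.funSplitAt q α).symm.sum_comp,
    Fintype.sum_prod_type, Fintype.sum_prod_type]
  simp only [e, Equiv.apply_symm_apply]
  rw [Finset.sum_const, nsmul_eq_mul, Finset.card_univ, Finset.sum_comm]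

/-- Summing over all labellings `f` of the letters of a word `w`, each letter contributes a factor
`n` at its last occurrence and a factor `C` at any other occurrence. -/
lemma sum_norm_sq_word_le {E Q : Type*} [NormedAddCommGroup E] [NormedSpace ℂ E]
    [Fintype Q] [DecidableEq Q] {n : ℕ} (A : Fin n → E →L[ℂ] E) {C : ℝ}
    (hC : 0 ≤ C) (hsum : ∀ x, ∑ k, ‖A k x‖ ^ 2 ≤ n * ‖x‖ ^ 2)
    (hmax : ∀ k x, ‖A k x‖ ^ 2 ≤ C * ‖x‖ ^ 2) (w : List Q) (x : E) :
    ∑ f : Q → Fin n, ‖(w.map fun q => A (f q)).prod x‖ ^ 2 ≤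
      (n : ℝ) ^ Fintype.card Q * C ^ (w.length - w.toFinset.card) * ‖x‖ ^ 2 := by
  induction w with
  | nil => simp
  | cons q w ih =>
    simp only [List.map_cons, List.prod_cons, mul_apply_eq_comp, List.length_cons,
      List.toFinset_cons]
    by_cases hq : q ∈ w
    · rw [Finset.insert_eq_of_mem (List.mem_toFinset.2 hq),
        Nat.sub_add_comm (List.toFinset_card_le w), pow_succ]
      calc _ ≤ ∑ f : Q → Fin n, C * ‖(w.map fun q => A (f q)).prod x‖ ^ 2 :=
            Finset.sum_le_sum fun f _ => hmax _ _
        _ ≤ C * ((n : ℝ) ^ Fintype.card Q * C ^ (w.length - w.toFinset.card) * ‖x‖ ^ 2) := by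
            rw [← Finset.mul_sum]
            gcongr
        _ = _ := by ring
    · rw [Finset.card_insert_of_notMem (by simpa using hq), Nat.add_sub_add_right]
      refine le_trans ?_ ih
      rcases Nat.eq_zero_or_pos n with rfl | hn
      · have : IsEmpty (Q → Fin 0) := ⟨fun f => (f q).elim0⟩
        simp
      have hn' : (0 : ℝ) < n := by exact_mod_cast hn
      refine le_of_mul_le_mul_left ?_ hn'
      have h := sum_update_eq_card_mul_sum q
        fun f : Q → Fin n => ‖A (f q) ((w.map fun q => A (f q)).prod x)‖ ^ 2
      rw [Fintype.card_fin] at h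
      rw [← h, Finset.mul_sum]
      refine Finset.sum_le_sum fun f _ => ?_
      have hw : ∀ k, (w.map fun a => A (Function.update f q k a)) = w.map fun a => A (f a) := by
        intro k
        refine List.map_congr_left fun a ha => ?_
        rw [Function.update_of_ne (ne_of_mem_of_not_mem ha hq)]
      simp only [hw, Function.update_self]
      exact hsum _

lemma sum_filter_kernel_le {j n : ℕ} (σ : Setoid (Fin j)) (F : (Fin j → Fin n) → ℝ)
    (hF : ∀ i, 0 ≤ F i) :
    ∑ i ∈ Finset.univ.filter (fun i : Fin j → Fin n => ∀ a b, i a = i b ↔ σ a b), F i ≤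
      ∑ f : Quotient σ → Fin n, F fun l => f (Quotient.mk σ l) := by
  have hinj : Function.Injective
      fun (f : Quotient σ → Fin n) (l : Fin j) => f (Quotient.mk σ l) := by
    intro f g h
    funext q
    induction q using Quotient.inductionOn with
    | h l => exact congrFun h l
  rw [← Finset.sum_image (f := F) hinj.injOn]
  refine Finset.sum_le_sum_of_subset_of_nonneg (fun i hi => ?_) fun i _ _ => hF i
  rw [Finset.mem_filter] at hi
  rw [Finset.mem_image]
  exact ⟨Quotient.lift i fun a b h => (hi.2 a b).2 h, Finset.mem_univ _, rfl⟩

theorem partition_folded_term_norm_bound {n j : ℕ} (hj : 2 ≤ j)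
    (A : Fin n → H →L[ℂ] H)
    (h1 : ‖∑ k, ContinuousLinearMap.adjoint (A k) * A k‖ ≤ n)
    (h2 : ‖∑ k, A k * ContinuousLinearMap.adjoint (A k)‖ ≤ n)
    (C : ℝ) (hC : C = ⨆ k, ‖ContinuousLinearMap.adjoint (A k) * A k‖) (hCpos : 0 < C)
    (σ : Setoid (Fin j))
    (hblock : ∃ b : Fin j, b ≠ ⟨0, by omega⟩ ∧ σ (⟨0, by omega⟩ : Fin j) b) :
    ‖∑ i ∈ Finset.univ.filter
        (fun i : Fin j → Fin n => ∀ a b, i a = i b ↔ σ a b),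
        ContinuousLinearMap.adjoint (((List.ofFn fun l => A (i l)).tail).prod) *
          ((1 - ContinuousLinearMap.adjoint (A (i ⟨0, by omega⟩)) * A (i ⟨0, by omega⟩)) *
            ((List.ofFn fun l => A (i l)).tail).prod)‖ ≤
      (n : ℝ) ^ Fintype.card (Quotient σ) * C ^ (j - Fintype.card (Quotient σ)) * (1 + 1 / C) := by
  obtain ⟨m, rfl⟩ : ∃ m, j = m + 1 := ⟨j - 1, by omega⟩
  obtain ⟨b, hb0, hb⟩ := hblock
  have hsum := sum_norm_sq_apply_le Finset.univ A h1
  have hmax : ∀ k x, ‖A k x‖ ^ 2 ≤ C * ‖x‖ ^ 2 := by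
    intro k x
    have h := sum_norm_sq_apply_le {k} A (K := C) (by
      rw [Finset.sum_singleton, hC]
      exact le_ciSup (f := fun k => ‖ContinuousLinearMap.adjoint (A k) * A k‖)
        (Set.finite_range _).bddAbove k) x
    simpa using h
  set ν := Fintype.card (Quotient σ) with hν
  let w : List (Quotient σ) := List.ofFn fun l : Fin m => Quotient.mk σ l.succ
  have hw : ∀ q, q ∈ w := by
    intro q
    induction q using Quotient.inductionOn with
    | h l =>
      rw [List.mem_ofFn]
      rcases Fin.eq_zero_or_eq_succ l with rfl | ⟨l', rfl⟩
      · obtain ⟨b', rfl⟩ := Fin.exists_succ_eq.2 hb0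
        exact ⟨b', (Quotient.sound hb).symm⟩
      · exact ⟨l', rfl⟩
  have hwcard : w.toFinset.card = ν := by
    rw [hν, ← Finset.card_univ]
    congr 1
    ext q
    simp [hw q]
  have hwlen : w.length = m := List.length_ofFn
  have hνm : ν ≤ m := by
    have h := List.toFinset_card_le w
    rwa [hwcard, hwlen] at h
  have hw₀card : (Quotient.mk σ 0 :: w).toFinset.card = ν := by
    rw [List.toFinset_cons, Finset.insert_eq_of_mem (List.mem_toFinset.2 (hw _)), hwcard]
  set S := Finset.univ.filter (fun i : Fin (m + 1) → Fin n => ∀ a b, i a = i b ↔ σ a b)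
  let P : (Fin (m + 1) → Fin n) → H →L[ℂ] H :=
    fun i => (List.ofFn fun l : Fin m => A (i l.succ)).prod
  have hP : ∀ f : Quotient σ → Fin n,
      P (fun l => f (Quotient.mk σ l)) = (w.map fun q => A (f q)).prod := by
    intro f
    simp only [P, w, List.map_ofFn]
    rfl
  have hT₁ : ‖∑ i ∈ S, ContinuousLinearMap.adjoint (P i) * P i‖ ≤ (n : ℝ) ^ ν * C ^ (m - ν) := by
    refine norm_sum_adjoint_mul_self_le _ _ (by positivity) fun x => ?_
    refine (sum_filter_kernel_le σ (fun i => ‖P i x‖ ^ 2) fun i => by positivity).trans ?_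
    have h := sum_norm_sq_word_le A hCpos.le hsum hmax w x
    rw [hwcard, hwlen] at h
    simpa only [hP] using h
  have hT₂ : ‖∑ i ∈ S, ContinuousLinearMap.adjoint (A (i 0) * P i) * (A (i 0) * P i)‖ ≤
      (n : ℝ) ^ ν * C ^ (m + 1 - ν) := by
    refine norm_sum_adjoint_mul_self_le _ _ (by positivity) fun x => ?_
    refine (sum_filter_kernel_le σ (fun i => ‖(A (i 0) * P i) x‖ ^ 2)
      fun i => by positivity).trans ?_
    have h := sum_norm_sq_word_le A hCpos.le hsum hmax (Quotient.mk σ 0 :: w) x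
    rw [hw₀card, List.length_cons, hwlen] at h
    simpa only [hP, List.map_cons, List.prod_cons] using h
  calc _ = ‖∑ i ∈ S, ContinuousLinearMap.adjoint (P i) * P i -
        ∑ i ∈ S, ContinuousLinearMap.adjoint (A (i 0) * P i) * (A (i 0) * P i)‖ := by
        rw [← Finset.sum_sub_distrib]
        congr 1
        refine Finset.sum_congr rfl fun i _ => ?_
        have hi : (List.ofFn fun l => A (i l)).tail.prod = P i := by
          simp [P, List.ofFn_succ]
        have h0 : (⟨0, by omega⟩ : Fin (m + 1)) = 0 := rfl
        simp only [hi, h0, ← ContinuousLinearMap.star_eq_adjoint, star_mul]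
        noncomm_ring
    _ ≤ (n : ℝ) ^ ν * C ^ (m - ν) + (n : ℝ) ^ ν * C ^ (m + 1 - ν) :=
        (norm_sub_le _ _).trans (add_le_add hT₁ hT₂)
    _ = _ := by
        rw [Nat.sub_add_comm hνm, pow_succ]
        field_simp
        ring
end
end

section
/- Let H be a complex Hilbert space, ε ≥ 0, and A_1,…,A_n bounded operators on H with ‖Σ_{i=1}^n A_i*A_i − n·1‖ ≤ nε, and set C = max_{1≤k≤n} ‖A_k*A_k‖. For 1 ≤ d ≤ n define f(d) = Σ_{j=1}^{d} (nε + (1+C)(j−1))/(n−j+1). Then ‖E_wo,d(A) − E_wr,d(A)‖ ≤ f(d)·exp(f(d)) + (1+ε)^d − 1, and consequently ‖E_wo,d(A)‖ ≤ ‖E_wr,d(A)‖ + f(d)·exp(f(d)) + (1+ε)^d − 1. -/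
open scoped BigOperators

noncomputable section

variable {H : Type*} [NormedAddCommGroup H] [InnerProductSpace ℂ H] [CompleteSpace H]

/-- The ordered product `A_{j_d} ⋯ A_{j_2} A_{j_1}` (composition, leftmost `A_{j_d}`). -/
def ordProd {n d : ℕ} (A : Fin n → H →L[ℂ] H) (j : Fin d → Fin n) : H →L[ℂ] H :=
  ((List.ofFn fun l => A (j l)).reverse).prod

/-- The without-replacement mean
`E_wo,d(A) = ((n−d)!/n!) · Σ_{j injective} A_{j 1}* ⋯ A_{j d}* A_{j d} ⋯ A_{j 1}`. -/
def woMean (n d : ℕ) (A : Fin n → H →L[ℂ] H) : H →L[ℂ] H :=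
  (((n - d).factorial : ℂ) / (n.factorial : ℂ)) •
    ∑ j ∈ Finset.univ.filter (fun j : Fin d → Fin n => Function.Injective j),
      ContinuousLinearMap.adjoint (ordProd A j) * ordProd A j

/-- The with-replacement mean
`E_wr,d(A) = n^{−d} · Σ_{j} A_{j 1}* ⋯ A_{j d}* A_{j d} ⋯ A_{j 1}`. -/
def wrMean (n d : ℕ) (A : Fin n → H →L[ℂ] H) : H →L[ℂ] H :=
  ((n : ℂ) ^ d)⁻¹ •
    ∑ j : Fin d → Fin n, ContinuousLinearMap.adjoint (ordProd A j) * ordProd A j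

/-- A Cauchy–Schwarz bound for sandwiched sums: `‖∑ P* M P‖ ≤ c ‖∑ P* P‖` if every `‖M‖ ≤ c`. -/
theorem norm_sum_adjoint_mul_mul_le {ι : Type*} (s : Finset ι) (P M : ι → H →L[ℂ] H) {c : ℝ}
    (hc : 0 ≤ c) (hM : ∀ j ∈ s, ‖M j‖ ≤ c) :
    ‖∑ j ∈ s, ContinuousLinearMap.adjoint (P j) * M j * P j‖ ≤
      c * ‖∑ j ∈ s, ContinuousLinearMap.adjoint (P j) * P j‖ := by
  set T := ∑ j ∈ s, ContinuousLinearMap.adjoint (P j) * P j with hT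
  have hsq (x : H) : ∑ j ∈ s, ‖P j x‖ ^ 2 ≤ ‖T‖ * ‖x‖ ^ 2 := by
    have h : inner ℂ x (T x) = ((∑ j ∈ s, ‖P j x‖ ^ 2 : ℝ) : ℂ) := by
      simp [hT, ContinuousLinearMap.adjoint_inner_right,
        inner_self_eq_norm_sq_to_K]
    have h' : ∑ j ∈ s, ‖P j x‖ ^ 2 = ‖inner ℂ x (T x)‖ := by
      rw [h, Complex.norm_real, Real.norm_of_nonneg (by positivity)]
    calc ∑ j ∈ s, ‖P j x‖ ^ 2 = ‖inner ℂ x (T x)‖ := h'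
      _ ≤ ‖x‖ * ‖T x‖ := norm_inner_le_norm _ _
      _ ≤ ‖x‖ * (‖T‖ * ‖x‖) := by gcongr; exact T.le_opNorm x
      _ = ‖T‖ * ‖x‖ ^ 2 := by ring
  have hinner (x y : H) : ‖inner ℂ y
      ((∑ j ∈ s, ContinuousLinearMap.adjoint (P j) * M j * P j) x)‖ ≤ c * ‖T‖ * ‖x‖ * ‖y‖ := by
    have hcs : ∑ j ∈ s, ‖P j y‖ * ‖P j x‖ ≤ ‖T‖ * ‖x‖ * ‖y‖ := by
      refine abs_le_of_sq_le_sq' ?_ (by positivity) |>.2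
      calc (∑ j ∈ s, ‖P j y‖ * ‖P j x‖) ^ 2
          ≤ (∑ j ∈ s, ‖P j y‖ ^ 2) * ∑ j ∈ s, ‖P j x‖ ^ 2 :=
            Finset.sum_mul_sq_le_sq_mul_sq _ _ _
        _ ≤ (‖T‖ * ‖y‖ ^ 2) * (‖T‖ * ‖x‖ ^ 2) := by
            gcongr
            · exact hsq y
            · exact hsq x
        _ = (‖T‖ * ‖x‖ * ‖y‖) ^ 2 := by ring
    calc _ = ‖∑ j ∈ s, inner ℂ (P j y) (M j (P j x))‖ := by
          simp [ContinuousLinearMap.adjoint_inner_right]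
      _ ≤ ∑ j ∈ s, ‖inner ℂ (P j y) (M j (P j x))‖ := norm_sum_le _ _
      _ ≤ ∑ j ∈ s, c * (‖P j y‖ * ‖P j x‖) := by
          refine Finset.sum_le_sum fun j hj => ?_
          calc _ ≤ ‖P j y‖ * ‖M j (P j x)‖ := norm_inner_le_norm _ _
            _ ≤ ‖P j y‖ * (c * ‖P j x‖) := by
                gcongr
                exact (M j).le_of_opNorm_le (hM j hj) _
            _ = _ := by ring
      _ = c * ∑ j ∈ s, ‖P j y‖ * ‖P j x‖ := by rw [Finset.mul_sum]
      _ ≤ c * (‖T‖ * ‖x‖ * ‖y‖) := by gcongr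
      _ = _ := by ring
  refine ContinuousLinearMap.opNorm_le_bound _ (by positivity) fun x => ?_
  set z := (∑ j ∈ s, ContinuousLinearMap.adjoint (P j) * M j * P j) x with hz
  have h := hinner x z
  rw [← hz, inner_self_eq_norm_sq_to_K] at h
  rcases (norm_nonneg z).eq_or_lt with h0 | h0
  · rw [← h0]; positivity
  · refine le_of_mul_le_mul_right ?_ h0
    simpa [pow_two] using h

omit [CompleteSpace H] in
/-- Multiplicative increments accumulate: if `‖E (k+1) - E k‖ ≤ a k ‖E k‖` and `E 0 = 1`,
then `‖E d - 1‖ ≤ ∏ (1 + a k) - 1`. -/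
theorem norm_sub_one_le_prod_one_add_sub_one (E : ℕ → H →L[ℂ] H) (a : ℕ → ℝ) (d : ℕ)
    (h0 : E 0 = 1) (ha : ∀ k < d, 0 ≤ a k)
    (hE : ∀ k < d, ‖E (k + 1) - E k‖ ≤ a k * ‖E k‖) :
    ‖E d - 1‖ ≤ ∏ k ∈ Finset.range d, (1 + a k) - 1 := by
  induction d with
  | zero => simp [h0]
  | succ d ih =>
    have ih := ih (fun k hk => ha k (by omega)) (fun k hk => hE k (by omega))
    have had := ha d (by omega)
    have hnorm : ‖E d‖ ≤ ‖E d - 1‖ + 1 :=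
      calc ‖E d‖ = ‖(E d - 1) + 1‖ := by rw [sub_add_cancel]
        _ ≤ ‖E d - 1‖ + ‖(1 : H →L[ℂ] H)‖ := norm_add_le _ _
        _ ≤ ‖E d - 1‖ + 1 := by gcongr; exact ContinuousLinearMap.norm_id_le
    rw [Finset.prod_range_succ]
    calc ‖E (d + 1) - 1‖ ≤ ‖E (d + 1) - E d‖ + ‖E d - 1‖ := norm_sub_le_norm_sub_add_norm_sub _ _ _
      _ ≤ a d * (∏ k ∈ Finset.range d, (1 + a k)) + ‖E d - 1‖ := by
          gcongr
          refine (hE d (by omega)).trans ?_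
          gcongr
          linarith
      _ ≤ _ := by linarith

omit [CompleteSpace H] in
theorem ordProd_snoc {n d : ℕ} (A : Fin n → H →L[ℂ] H) (j : Fin d → Fin n) (i : Fin n) :
    ordProd A (Fin.snoc j i : Fin (d + 1) → Fin n) = A i * ordProd A j := by
  simp [ordProd, List.ofFn_succ', -List.ofFn_succ]

theorem adjoint_ordProd_snoc_mul {n d : ℕ} (A : Fin n → H →L[ℂ] H) (j : Fin d → Fin n)
    (i : Fin n) :
    ContinuousLinearMap.adjoint (ordProd A (Fin.snoc j i : Fin (d + 1) → Fin n)) *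
        ordProd A (Fin.snoc j i : Fin (d + 1) → Fin n) =
      ContinuousLinearMap.adjoint (ordProd A j) * (ContinuousLinearMap.adjoint (A i) * A i) *
        ordProd A j := by
  rw [ordProd_snoc, ← ContinuousLinearMap.star_eq_adjoint, ← ContinuousLinearMap.star_eq_adjoint,
    ← ContinuousLinearMap.star_eq_adjoint, star_mul]
  simp only [mul_assoc]

theorem sum_adjoint_ordProd_succ {n d : ℕ} (A : Fin n → H →L[ℂ] H) :
    ∑ j : Fin (d + 1) → Fin n, ContinuousLinearMap.adjoint (ordProd A j) * ordProd A j =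
      ∑ j : Fin d → Fin n, ContinuousLinearMap.adjoint (ordProd A j) *
        (∑ i, ContinuousLinearMap.adjoint (A i) * A i) * ordProd A j := by
  rw [← (Fin.snocEquiv fun _ : Fin (d + 1) => Fin n).sum_comp, Fintype.sum_prod_type_right]
  refine Finset.sum_congr rfl fun j _ => ?_
  rw [Finset.mul_sum, Finset.sum_mul]
  exact Finset.sum_congr rfl fun i _ => adjoint_ordProd_snoc_mul A j i

theorem sum_injective_adjoint_ordProd_succ {n d : ℕ} (A : Fin n → H →L[ℂ] H) :
    ∑ j ∈ Finset.univ.filter (fun j : Fin (d + 1) → Fin n => Function.Injective j),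
        ContinuousLinearMap.adjoint (ordProd A j) * ordProd A j =
      ∑ j ∈ Finset.univ.filter (fun j : Fin d → Fin n => Function.Injective j),
        ContinuousLinearMap.adjoint (ordProd A j) *
          ((∑ i, ContinuousLinearMap.adjoint (A i) * A i) -
            ∑ l, ContinuousLinearMap.adjoint (A (j l)) * A (j l)) * ordProd A j := by
  classical
  rw [Finset.sum_filter, ← (Fin.snocEquiv fun _ : Fin (d + 1) => Fin n).sum_comp,
    Fintype.sum_prod_type_right, Finset.sum_filter]
  refine Finset.sum_congr rfl fun j _ => ?_
  change ∑ i, (if Function.Injective (Fin.snoc j i : Fin (d + 1) → Fin n) then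
    ContinuousLinearMap.adjoint (ordProd A (Fin.snoc j i : Fin (d + 1) → Fin n)) *
      ordProd A (Fin.snoc j i : Fin (d + 1) → Fin n) else 0) = _
  simp only [Fin.snoc_injective_iff, adjoint_ordProd_snoc_mul]
  split_ifs with hj
  · have hcompl : (∑ i, ContinuousLinearMap.adjoint (A i) * A i) -
        ∑ l, ContinuousLinearMap.adjoint (A (j l)) * A (j l) =
        ∑ i ∈ Finset.univ.filter (fun i => i ∉ Set.range j),
          ContinuousLinearMap.adjoint (A i) * A i := by
      rw [sub_eq_iff_eq_add,
        ← Finset.sum_filter_add_sum_filter_not Finset.univ (fun i => i ∉ Set.range j)]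
      congr 1
      rw [← Finset.sum_image (f := fun i => ContinuousLinearMap.adjoint (A i) * A i)
        (s := Finset.univ) (g := j) (fun _ _ _ _ h => hj h)]
      refine Finset.sum_congr ?_ fun _ _ => rfl
      ext i
      simp
    rw [hcompl, Finset.mul_sum, Finset.sum_mul, Finset.sum_filter]
    simp [hj]
  · simp [hj]

theorem wrMean_zero {n : ℕ} (A : Fin n → H →L[ℂ] H) : wrMean n 0 A = 1 := by
  simp [wrMean, ordProd, ← ContinuousLinearMap.star_eq_adjoint]

theorem woMean_zero {n : ℕ} (A : Fin n → H →L[ℂ] H) : woMean n 0 A = 1 := by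
  have h : (n.factorial : ℂ) ≠ 0 := by exact_mod_cast n.factorial_ne_zero
  simp [woMean, ordProd, ← ContinuousLinearMap.star_eq_adjoint, h,
    Function.injective_of_subsingleton]

theorem norm_wrMean_succ_sub_le {n : ℕ} (hn : 0 < n) (d : ℕ) {ε : ℝ} (hε : 0 ≤ ε)
    (A : Fin n → H →L[ℂ] H)
    (hA : ‖(∑ i, ContinuousLinearMap.adjoint (A i) * A i) - (n : ℂ) • (1 : H →L[ℂ] H)‖ ≤ n * ε) :
    ‖wrMean n (d + 1) A - wrMean n d A‖ ≤ ε * ‖wrMean n d A‖ := by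
  have hn' : (n : ℂ) ≠ 0 := by exact_mod_cast hn.ne'
  have hnr : (n : ℝ) ≠ 0 := by exact_mod_cast hn.ne'
  have key : wrMean n (d + 1) A - wrMean n d A = ((n : ℂ) ^ (d + 1))⁻¹ •
      ∑ j : Fin d → Fin n, ContinuousLinearMap.adjoint (ordProd A j) *
        ((∑ i, ContinuousLinearMap.adjoint (A i) * A i) - (n : ℂ) • (1 : H →L[ℂ] H)) *
          ordProd A j := by
    have hs : ((n : ℂ) ^ d)⁻¹ = ((n : ℂ) ^ (d + 1))⁻¹ * n := by rw [pow_succ]; field_simp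
    rw [wrMean, wrMean, sum_adjoint_ordProd_succ, hs, mul_smul, ← smul_sub, Finset.smul_sum,
      ← Finset.sum_sub_distrib]
    simp [mul_sub, sub_mul]
  rw [key, norm_smul]
  refine (mul_le_mul_of_nonneg_left (norm_sum_adjoint_mul_mul_le _ _ _ (by positivity)
    fun _ _ => hA) (norm_nonneg _)).trans_eq ?_
  rw [wrMean, norm_smul]
  simp only [norm_inv, norm_pow, Complex.norm_natCast]
  rw [pow_succ]
  field_simp

theorem norm_woMean_succ_sub_le {n d : ℕ} (hdn : d < n) {ε : ℝ} (hε : 0 ≤ ε)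
    (A : Fin n → H →L[ℂ] H)
    (hA : ‖(∑ i, ContinuousLinearMap.adjoint (A i) * A i) - (n : ℂ) • (1 : H →L[ℂ] H)‖ ≤ n * ε)
    {C : ℝ} (hC0 : 0 ≤ C) (hC : ∀ k, ‖ContinuousLinearMap.adjoint (A k) * A k‖ ≤ C) :
    ‖woMean n (d + 1) A - woMean n d A‖ ≤
      ((n : ℝ) * ε + (1 + C) * d) / ((n : ℝ) - d) * ‖woMean n d A‖ := by
  obtain ⟨m, rfl⟩ : ∃ m, n = d + m + 1 := ⟨n - d - 1, by omega⟩
  have hsub : d + m + 1 - d = m + 1 := by omega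
  have hsub' : d + m + 1 - (d + 1) = m := by omega
  have hfac : ((d + m + 1).factorial : ℂ) ≠ 0 := by exact_mod_cast Nat.factorial_ne_zero _
  have key : woMean (d + m + 1) (d + 1) A - woMean (d + m + 1) d A =
      ((m.factorial : ℂ) / ((d + m + 1).factorial : ℂ)) •
      ∑ j ∈ Finset.univ.filter (fun j : Fin d → Fin (d + m + 1) => Function.Injective j),
        ContinuousLinearMap.adjoint (ordProd A j) *
        ((∑ i, ContinuousLinearMap.adjoint (A i) * A i) -
          (∑ l, ContinuousLinearMap.adjoint (A (j l)) * A (j l)) -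
          ((m + 1 : ℕ) : ℂ) • (1 : H →L[ℂ] H)) * ordProd A j := by
    have hs : ((m + 1).factorial : ℂ) / ((d + m + 1).factorial : ℂ) =
        (m.factorial : ℂ) / ((d + m + 1).factorial : ℂ) * ((m + 1 : ℕ) : ℂ) := by
      rw [Nat.factorial_succ]; push_cast; ring
    rw [woMean, woMean, sum_injective_adjoint_ordProd_succ, hsub, hsub', hs, mul_smul, ← smul_sub,
      Finset.smul_sum (r := ((m + 1 : ℕ) : ℂ)), ← Finset.sum_sub_distrib]
    congr 1
    refine Finset.sum_congr rfl fun j _ => ?_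
    rw [mul_sub _ _ (((m + 1 : ℕ) : ℂ) • (1 : H →L[ℂ] H)), sub_mul, mul_smul_comm, mul_one,
      smul_mul_assoc]
  have hbound (j : Fin d → Fin (d + m + 1)) :
      ‖(∑ i, ContinuousLinearMap.adjoint (A i) * A i) -
          (∑ l, ContinuousLinearMap.adjoint (A (j l)) * A (j l)) -
          ((m + 1 : ℕ) : ℂ) • (1 : H →L[ℂ] H)‖ ≤
        ((d + m + 1 : ℕ) : ℝ) * ε + (1 + C) * d := by
    have hone : ‖(d : ℂ) • (1 : H →L[ℂ] H)‖ ≤ d := by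
      rw [norm_smul, Complex.norm_natCast]
      exact mul_le_of_le_one_right (by positivity) ContinuousLinearMap.norm_id_le
    have hsum : ‖∑ l, ContinuousLinearMap.adjoint (A (j l)) * A (j l)‖ ≤ d * C := by
      simpa using norm_sum_le_of_le Finset.univ fun l _ => hC (j l)
    have hsplit : (∑ i, ContinuousLinearMap.adjoint (A i) * A i) -
          (∑ l, ContinuousLinearMap.adjoint (A (j l)) * A (j l)) -
          ((m + 1 : ℕ) : ℂ) • (1 : H →L[ℂ] H) =
        ((∑ i, ContinuousLinearMap.adjoint (A i) * A i) -
          ((d + m + 1 : ℕ) : ℂ) • (1 : H →L[ℂ] H)) + (d : ℂ) • (1 : H →L[ℂ] H) -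
          ∑ l, ContinuousLinearMap.adjoint (A (j l)) * A (j l) := by
      push_cast
      module
    rw [hsplit]
    refine (norm_sub_le _ _).trans ?_
    have := norm_add_le ((∑ i, ContinuousLinearMap.adjoint (A i) * A i) -
          ((d + m + 1 : ℕ) : ℂ) • (1 : H →L[ℂ] H)) ((d : ℂ) • (1 : H →L[ℂ] H))
    linarith
  rw [key, norm_smul]
  refine (mul_le_mul_of_nonneg_left (norm_sum_adjoint_mul_mul_le _ _ _ (by positivity)
    fun j _ => hbound j) (norm_nonneg _)).trans_eq ?_
  rw [woMean, norm_smul, hsub, Nat.factorial_succ m]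
  simp only [norm_div, Complex.norm_natCast]
  have hm : (((d + m + 1 : ℕ) : ℝ) - d) = m + 1 := by push_cast; ring
  have hm' : (m : ℝ) + 1 ≠ 0 := by positivity
  rw [hm]
  push_cast
  field_simp

theorem wo_wr_comparison {n d : ℕ} (hd : 1 ≤ d) (hdn : d ≤ n)
    (ε : ℝ) (hε : 0 ≤ ε)
    (A : Fin n → H →L[ℂ] H)
    (hA : ‖(∑ i, ContinuousLinearMap.adjoint (A i) * A i) - (n : ℂ) • (1 : H →L[ℂ] H)‖ ≤ n * ε)
    (C : ℝ) (hC : C = ⨆ k, ‖ContinuousLinearMap.adjoint (A k) * A k‖)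
    (f : ℝ)
    (hf : f = ∑ j ∈ Finset.range d, ((n : ℝ) * ε + (1 + C) * j) / ((n : ℝ) - j)) :
    ‖woMean n d A - wrMean n d A‖ ≤ f * Real.exp f + ((1 + ε) ^ d - 1) ∧
      ‖woMean n d A‖ ≤ ‖wrMean n d A‖ + f * Real.exp f + ((1 + ε) ^ d - 1) := by
  have hn : 0 < n := by omega
  have hCk (k : Fin n) : ‖ContinuousLinearMap.adjoint (A k) * A k‖ ≤ C := by
    rw [hC]
    exact le_ciSup (f := fun k => ‖ContinuousLinearMap.adjoint (A k) * A k‖)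
      (Set.finite_range _).bddAbove k
  have hC0 : 0 ≤ C := (norm_nonneg _).trans (hCk ⟨0, hn⟩)
  have hnonneg : ∀ k < d, 0 ≤ ((n : ℝ) * ε + (1 + C) * k) / ((n : ℝ) - k) := by
    intro k hk
    have : (k : ℝ) ≤ n := by exact_mod_cast (hk.le.trans hdn)
    exact div_nonneg (by positivity) (by linarith)
  have hwo : ‖woMean n d A - 1‖ ≤ f * Real.exp f := by
    have h := norm_sub_one_le_prod_one_add_sub_one (fun k => woMean n k A)
      (fun k => ((n : ℝ) * ε + (1 + C) * k) / ((n : ℝ) - k)) d (woMean_zero A) hnonneg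
      fun k hk => norm_woMean_succ_sub_le (hk.trans_le hdn) hε A hA hC0 hCk
    have hprod : ∏ k ∈ Finset.range d, (1 + ((n : ℝ) * ε + (1 + C) * k) / ((n : ℝ) - k)) ≤
        Real.exp f := by
      rw [hf, Real.exp_sum]
      refine Finset.prod_le_prod (fun k hk => ?_) fun k _ => ?_
      · linarith [hnonneg k (Finset.mem_range.1 hk)]
      · linarith [Real.add_one_le_exp (((n : ℝ) * ε + (1 + C) * k) / ((n : ℝ) - k))]
    have hexp : Real.exp f - 1 ≤ f * Real.exp f := by
      have h1 := mul_le_mul_of_nonneg_right (Real.add_one_le_exp (-f)) (Real.exp_pos f).le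
      rw [← Real.exp_add, neg_add_cancel, Real.exp_zero] at h1
      linarith
    linarith
  have hwr : ‖wrMean n d A - 1‖ ≤ (1 + ε) ^ d - 1 := by
    simpa using norm_sub_one_le_prod_one_add_sub_one (fun k => wrMean n k A)
      (fun _ => ε) d (wrMean_zero A) (fun _ _ => hε)
      fun k _ => norm_wrMean_succ_sub_le hn k hε A hA
  have hdiff : ‖woMean n d A - wrMean n d A‖ ≤ f * Real.exp f + ((1 + ε) ^ d - 1) := by
    have h := norm_sub_le (woMean n d A - 1) (wrMean n d A - 1)
    rw [sub_sub_sub_cancel_right] at h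
    linarith
  refine ⟨hdiff, ?_⟩
  have h := norm_sub_norm_le (woMean n d A) (wrMean n d A)
  linarith
end
end
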